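/- arXiv:2505.12243 — 2 statements merged into one kernel-verified Lean document; each statement's English description precedes it below -/
import Mathlib

section
/- For all integers n, k, r with 1 ≤ r ≤ k ≤ n-1, the identity 1 = Σ_{j=r}^{k} (-1)^{r+j} C(j-1, r-1) C(n, j) + (-1)^{r+k+1} Σ_{i=1}^{r} C(k-i, r-i) C(n-i, k-i+1) holds. (This is the case P(X = n) = 1 of the exact error formula, and shows that when every event A_i equals the whole sample space the improved bound of the form Σ_{j=r}^{k} (-1)^{r+j} C(j-1, r-1) S_j + (-1)^{r+k+1} α S_{k+1} with α = Σ_{i=1}^{r} C(k-i, r-i) C(k+1, i)/C(n, i) holds with equality.) -/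
/-- Reindexed remainder sums for consecutive truncation levels add up to a single product. -/
theorem sum_choose_mul_choose_add_succ (d e r : ℕ) :
    (∑ t ∈ Finset.range r, (d + t).choose t * (e + t).choose (d + t + 1))
      + ∑ t ∈ Finset.range r, (d + 1 + t).choose t * (e + t).choose (d + 1 + t + 1)
      = (d + r).choose (d + 1) * (e + r).choose (d + r + 1) := by
  induction r with
  | zero => simp
  | succ r ih =>
    rw [Finset.sum_range_succ, Finset.sum_range_succ]
    have h1 : (d + r).choose r = (d + r).choose d := Nat.choose_symm_add.symm
    have h2 : (d + 1 + r).choose r = (d + r + 1).choose (d + 1) := by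
      rw [← Nat.choose_symm_add, Nat.add_right_comm]
    have h3 := Nat.choose_succ_succ' (d + r) d
    have h4 := Nat.choose_succ_succ' (e + r) (d + r + 1)
    rw [← add_assoc d r 1, ← add_assoc e r 1, h4, h1, h2, Nat.add_right_comm d 1 r, h3]
    linear_combination ih

/-- A hockey-stick identity along a diagonal of Pascal's triangle. -/
theorem sum_choose_diagonal_add_one (e r : ℕ) :
    (∑ t ∈ Finset.range r, (e + t).choose (t + 1)) + 1 = (e + r).choose r := by
  induction r with
  | zero => simp
  | succ r ih =>
    rw [Finset.sum_range_succ, ← add_assoc e r 1, Nat.choose_succ_succ' (e + r) r]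
    linear_combination ih

/-- The truncated alternating sum with its remainder, with all indices shifted to start at `0`. -/
theorem alternating_sum_choose_sub_remainder (d e r : ℕ) :
    (1 : ℤ)
      = (∑ s ∈ Finset.range (d + 1),
          (-1 : ℤ) ^ s * ((r + s).choose r : ℤ) * ((e + (r + 1)).choose (r + 1 + s) : ℤ))
        + (-1 : ℤ) ^ (d + 1) *
            ∑ t ∈ Finset.range (r + 1),
              ((d + t).choose t : ℤ) * ((e + t).choose (d + t + 1) : ℤ) := by
  induction d with
  | zero =>
    have h : (∑ t ∈ Finset.range (r + 1), ((e + t).choose (t + 1) : ℤ)) + 1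
        = ((e + (r + 1)).choose (r + 1) : ℤ) := by
      exact_mod_cast sum_choose_diagonal_add_one e (r + 1)
    simp only [zero_add, Finset.sum_range_one, Nat.choose_self, add_zero]
    simp only [Nat.cast_one, one_mul]
    linear_combination h
  | succ d ih =>
    have h : (∑ t ∈ Finset.range (r + 1),
          ((d + t).choose t : ℤ) * ((e + t).choose (d + t + 1) : ℤ))
        + ∑ t ∈ Finset.range (r + 1),
          ((d + 1 + t).choose t : ℤ) * ((e + t).choose (d + 1 + t + 1) : ℤ)
        = ((d + (r + 1)).choose (d + 1) : ℤ) * ((e + (r + 1)).choose (d + (r + 1) + 1) : ℤ) := by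
      exact_mod_cast sum_choose_mul_choose_add_succ d e (r + 1)
    have h1 : (d + (r + 1)).choose (d + 1) = (r + (d + 1)).choose r := by
      rw [Nat.choose_symm_add, add_left_comm]
    rw [h1, show d + (r + 1) + 1 = r + 1 + (d + 1) by ring] at h
    rw [Finset.sum_range_succ]
    linear_combination ih + (-1 : ℤ) ^ (d + 1) * h


/-- for `1 ≤ r ≤ k ≤ n-1`,
`1 = ∑_{j=r}^{k} (-1)^{r+j} C(j-1, r-1) C(n, j)
     + (-1)^{r+k+1} ∑_{i=1}^{r} C(k-i, r-i) C(n-i, k-i+1)`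
(the case `P(X = n) = 1` of the exact error formula). -/
theorem exact_error_formula_at_full (n k r : ℕ) (hr1 : 1 ≤ r) (hrk : r ≤ k) (hkn : k + 1 ≤ n) :
    (1 : ℤ)
      = (∑ j ∈ Finset.Icc r k,
          (-1 : ℤ) ^ (r + j) * ((j - 1).choose (r - 1) : ℤ) * (n.choose j : ℤ))
        + (-1 : ℤ) ^ (r + k + 1) *
            ∑ i ∈ Finset.Icc 1 r,
              ((k - i).choose (r - i) : ℤ) * ((n - i).choose (k - i + 1) : ℤ) := by
  obtain ⟨r, rfl⟩ := Nat.exists_eq_add_of_le' hr1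
  obtain ⟨d, rfl⟩ := Nat.exists_eq_add_of_le hrk
  obtain ⟨e, rfl⟩ := Nat.exists_eq_add_of_le' (show r + 1 ≤ n by omega)
  have hs : (∑ j ∈ Finset.Icc (r + 1) (r + 1 + d), (-1 : ℤ) ^ (r + 1 + j)
        * ((j - 1).choose (r + 1 - 1) : ℤ) * ((e + (r + 1)).choose j : ℤ))
      = ∑ s ∈ Finset.range (d + 1),
          (-1 : ℤ) ^ s * ((r + s).choose r : ℤ) * ((e + (r + 1)).choose (r + 1 + s) : ℤ) := by
    rw [← Finset.Ico_add_one_right_eq_Icc, Finset.sum_Ico_eq_sum_range,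
      show r + 1 + d + 1 - (r + 1) = d + 1 by omega]
    refine Finset.sum_congr rfl fun s _ => ?_
    rw [show r + 1 + s - 1 = r + s by omega, Nat.add_sub_cancel, ← add_assoc, pow_add,
      Even.neg_one_pow ⟨r + 1, rfl⟩, one_mul]
  have ht : (∑ i ∈ Finset.Icc 1 (r + 1), ((r + 1 + d - i).choose (r + 1 - i) : ℤ)
        * ((e + (r + 1) - i).choose (r + 1 + d - i + 1) : ℤ))
      = ∑ t ∈ Finset.range (r + 1),
          ((d + t).choose t : ℤ) * ((e + t).choose (d + t + 1) : ℤ) := by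
    rw [← Finset.Ico_add_one_right_eq_Icc, Finset.sum_Ico_eq_sum_range, Nat.add_sub_cancel,
      ← Finset.sum_range_reflect]
    refine Finset.sum_congr rfl fun t ht => ?_
    have := Finset.mem_range.mp ht
    rw [show r + 1 + d - (1 + (r + 1 - 1 - t)) = d + t by omega,
      show r + 1 - (1 + (r + 1 - 1 - t)) = t by omega,
      show e + (r + 1) - (1 + (r + 1 - 1 - t)) = e + t by omega]
  rw [hs, ht, show r + 1 + (r + 1 + d) + 1 = (r + 1 + (r + 1)) + (d + 1) by ring, pow_add,
    Even.neg_one_pow ⟨r + 1, rfl⟩, one_mul]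
  exact alternating_sum_choose_sub_remainder d e r
end

section
/- For all integers k, r with 1 ≤ r ≤ k ≤ n-1 and r + k even, P(X ≥ r) ≤ Σ_{j=r}^{k} (-1)^{r+j} C(j-1, r-1) S_j − Σ_{i=1}^{r} C(k-i, r-i) Σ_{1 ≤ r_1 < ⋯ < r_{k+1-i} ≤ n} max_{(t_1, …, t_i) ∈ T(r_1, …, r_{k+1-i})} P(A_{r_1} ∩ ⋯ ∩ A_{r_{k+1-i}} ∩ A_{t_1} ∩ ⋯ ∩ A_{t_i}), where T(r_1, …, r_{k+1-i}) = {(t_1, …, t_i) : r_{k+1-i} < t_1 < ⋯ < t_i ≤ n} and the maximum over an empty set is 0. -/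
open MeasureTheory Finset
open scoped Classical

/-- Pascal's rule with a truncated predecessor in the upper entry. -/
lemma Nat.choose_pred_add_choose_pred (m k : ℕ) (hk : 1 ≤ k) :
    (m - 1).choose k + (m - 1).choose (k + 1) = m.choose (k + 1) := by
  cases m with
  | zero => simp [Nat.choose_eq_zero_of_lt (show 0 < k by omega)]
  | succ m => simp [Nat.choose_succ_succ']

lemma sum_choose_mul_choose_add_succ_s16 (r k m : ℕ) (hrk : r ≤ k) :
    (∑ i ∈ range (r + 1), (k - i).choose (r - i) * (m - (i + 1)).choose (k + 1 - i)) +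
      (∑ i ∈ range (r + 1), (k + 1 - i).choose (r - i) * (m - (i + 1)).choose (k + 2 - i)) =
      (k + 1).choose r * m.choose (k + 2) := by
  induction r generalizing k m with
  | zero => simpa using Nat.choose_pred_add_choose_pred m (k + 1) (by omega)
  | succ r ih =>
    obtain ⟨k, rfl⟩ : ∃ l, k = l + 1 := ⟨k - 1, by omega⟩
    have h := ih k (m - 1) (by omega)
    rw [sum_range_succ', sum_range_succ' _ (r + 1)]
    simp only [Nat.add_sub_add_right, Nat.sub_zero, zero_add,
      show ∀ i, k + 1 + 2 - (i + 1) = k + 2 - i from fun i => by omega,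
      show ∀ i, m - (i + 1 + 1) = m - 1 - (i + 1) from fun i => by omega]
    rw [← Nat.choose_pred_add_choose_pred m (k + 1 + 1) (by omega),
      Nat.choose_succ_succ' (k + 1) r] at *
    simp only [show k + 1 + 2 = k + 1 + 1 + 1 from rfl, show k + 2 = k + 1 + 1 from rfl] at *
    linear_combination h

lemma choose_eq_ite_add_sum_choose (r m : ℕ) :
    m.choose r = (if r ≤ m then 1 else 0) +
      ∑ i ∈ range r, (m - (i + 1)).choose (r - i) := by
  induction r generalizing m with
  | zero => simp
  | succ r ih =>
    cases m with
    | zero =>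
      rw [sum_eq_zero]
      · simp
      · intro i hi
        exact Nat.choose_eq_zero_of_lt (by have := mem_range.mp hi; omega)
    | succ m =>
      rw [sum_range_succ', Nat.choose_succ_succ', ih m]
      simp only [Nat.add_sub_add_right, add_le_add_iff_right, zero_add, Nat.sub_zero]
      simp only [Nat.add_sub_cancel]
      ring

/-- The alternating partial sums of the inclusion-exclusion formula for `r ≤ m`,
with explicit remainder. -/
lemma sum_Icc_neg_one_pow_choose (r k m : ℕ) (hr : 1 ≤ r) (hrk : r ≤ k) :
    ∑ j ∈ Icc r k, (-1 : ℝ) ^ (r + j) * ((j - 1).choose (r - 1)) * (m.choose j) =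
      (if r ≤ m then 1 else 0) + (-1 : ℝ) ^ (r + k) *
        ∑ i ∈ Icc 1 r, ((k - i).choose (r - i) : ℝ) * ((m - i).choose (k + 1 - i)) := by
  obtain ⟨r, rfl⟩ : ∃ l, r = l + 1 := ⟨r - 1, by omega⟩
  have hIcc (f : ℕ → ℝ) : ∑ i ∈ Icc 1 (r + 1), f i = ∑ i ∈ range (r + 1), f (i + 1) := by
    rw [range_eq_Ico, sum_Ico_add' f 0 (r + 1) 1]
    rfl
  induction k, hrk using Nat.le_induction with
  | base =>
    have h := choose_eq_ite_add_sum_choose (r + 1) m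
    rw [hIcc]
    simp only [Icc_self, sum_singleton, Nat.choose_self, ← two_mul, pow_mul, Nat.add_sub_add_right]
    simp only [h]
    push_cast
    norm_num
  | succ k hk ih =>
    rw [sum_Icc_succ_top (by omega), ih]
    obtain ⟨k, rfl⟩ : ∃ l, k = l + 1 := ⟨k - 1, by omega⟩
    have h := sum_choose_mul_choose_add_succ_s16 r k m (by omega)
    rw [hIcc, hIcc]
    simp only [Nat.add_sub_add_right, Nat.add_sub_cancel]
    have h' := congrArg (Nat.cast : ℕ → ℝ) h
    push_cast at h'
    simp only [show k + 1 + 1 = k + 2 from rfl] at *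
    rw [show r + 1 + (k + 2) = r + 1 + (k + 1) + 1 by ring, pow_succ]
    linear_combination (-1 : ℝ) ^ (r + 1 + (k + 1)) * h'

lemma card_filter_le_card_filter_lt_le {α : Type*} [LinearOrder α] (S : Finset α) (i : ℕ) :
    #{x ∈ S | i ≤ #{y ∈ S | x < y}} ≤ #S - i := by
  set L := {x ∈ S | i ≤ #{y ∈ S | x < y}} with hL
  rcases L.eq_empty_or_nonempty with h | h
  · simp [h]
  · have hx := mem_filter.mp (L.max'_mem h)
    have hd : Disjoint L {y ∈ S | L.max' h < y} := by
      rw [disjoint_left]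
      intro a ha ha'
      exact absurd (L.le_max' a ha) (not_le.mpr (mem_filter.mp ha').2)
    have hc := card_le_card (union_subset (filter_subset _ S)
      (filter_subset (fun y => L.max' h < y) S) : L ∪ _ ⊆ S)
    rw [card_union_of_disjoint hd] at hc
    omega

/-- There are at most `(#S - i).choose c` many `c`-subsets of `S` having at least `i` elements
of `S` above them. -/
lemma card_le_choose_of_exists_above {α : Type*} [LinearOrder α] (S : Finset α) (c i : ℕ)
    (𝓡 : Finset (Finset α))
    (h : ∀ R ∈ 𝓡, #R = c ∧ ∃ T, #T = i ∧ (∀ a ∈ R, ∀ t ∈ T, a < t) ∧ R ∪ T ⊆ S) :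
    #𝓡 ≤ (#S - i).choose c := by
  calc #𝓡 ≤ #(powersetCard c {x ∈ S | i ≤ #{y ∈ S | x < y}}) := by
        apply card_le_card
        intro R hR
        obtain ⟨hc, T, hT, hlt, hS⟩ := h R hR
        refine mem_powersetCard.mpr
          ⟨fun x hx => mem_filter.mpr ⟨hS (mem_union_left _ hx), ?_⟩, hc⟩
        rw [← hT]
        exact card_le_card fun t ht =>
          mem_filter.mpr ⟨hS (mem_union_right _ ht), hlt x hx t ht⟩
    _ ≤ _ := by
        rw [card_powersetCard]
        exact Nat.choose_le_choose c (card_filter_le_card_filter_lt_le S i)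

/-- A finite supremum of measures of measurable sets is attained, by `∅` if there are none. -/
lemma exists_measurableSet_measure_eq_sup {Ω ι : Type*} [MeasurableSpace Ω] (P : Measure Ω)
    (s : Finset ι) (E : ι → Set Ω) (hE : ∀ t ∈ s, MeasurableSet (E t)) :
    ∃ B, MeasurableSet B ∧ P B = s.sup (fun t => P (E t)) ∧ ∀ ω ∈ B, ∃ t ∈ s, ω ∈ E t := by
  rcases s.eq_empty_or_nonempty with rfl | h
  · exact ⟨∅, by simp⟩
  · obtain ⟨t, ht, he⟩ := exists_mem_eq_sup s h (fun t => P (E t))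
    exact ⟨E t, hE t ht, he.symm, fun ω hω => ⟨t, ht, hω⟩⟩

/-- refined upper bound.  For `1 ≤ r ≤ k ≤ n-1` with `r + k` even,
`P(X ≥ r) ≤ ∑_{j=r}^{k} (-1)^{r+j} C(j-1,r-1) S_j
   − ∑_{i=1}^{r} C(k-i,r-i) ∑_{r_1 < ⋯ < r_{k+1-i}}
       max_{(t_1,…,t_i) ∈ T(r_1,…,r_{k+1-i})} P(A_{r_1} ∩ ⋯ ∩ A_{r_{k+1-i}} ∩ A_{t_1} ∩ ⋯ ∩ A_{t_i})`,
where the maximum is over all `i`-element index sets `T` whose elements all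
exceed every element of `R` (the maximum over an empty set being `0`). -/
theorem refined_upper_bound
    {Ω : Type*} [MeasurableSpace Ω] (P : Measure Ω) [IsProbabilityMeasure P]
    (n : ℕ) (A : Fin n → Set Ω) (hA : ∀ l, MeasurableSet (A l))
    (k r : ℕ) (hr1 : 1 ≤ r) (hrk : r ≤ k) (hkn : k + 1 ≤ n) (heven : Even (r + k)) :
    (P {ω | r ≤ (Finset.univ.filter (fun l => ω ∈ A l)).card}).toReal
      ≤ (∑ j ∈ Finset.Icc r k,
          (-1 : ℝ) ^ (r + j) * ((j - 1).choose (r - 1)) *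
            ∑ T ∈ Finset.powersetCard j (Finset.univ : Finset (Fin n)),
              (P (⋂ l ∈ T, A l)).toReal)
        - ∑ i ∈ Finset.Icc 1 r,
            ((k - i).choose (r - i) : ℝ) *
              ∑ R ∈ Finset.powersetCard (k + 1 - i) (Finset.univ : Finset (Fin n)),
                (((Finset.powersetCard i (Finset.univ : Finset (Fin n))).filter
                      (fun T => ∀ a ∈ R, ∀ t ∈ T, a < t)).sup
                    (fun T => P (⋂ l ∈ R ∪ T, A l))).toReal := by
  have hB (i : ℕ) (R : Finset (Fin n)) :=
    exists_measurableSet_measure_eq_sup P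
      ((Finset.powersetCard i (Finset.univ : Finset (Fin n))).filter
        (fun T => ∀ a ∈ R, ∀ t ∈ T, a < t)) (fun T => ⋂ l ∈ R ∪ T, A l)
      (fun T _ => Finset.measurableSet_biInter _ fun l _ => hA l)
  choose B hBm hBP hBω using hB
  simp only [← hBP]
  let S : Ω → Finset (Fin n) := fun ω => univ.filter (fun l => ω ∈ A l)
  have hX : MeasurableSet {ω | r ≤ #(S ω)} := by
    simp only [S, card_filter]
    exact measurableSet_le measurable_const
      (Finset.measurable_sum _ fun l _ => Measurable.ite (hA l) measurable_const measurable_const)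
  have hI (T : Finset (Fin n)) : MeasurableSet (⋂ l ∈ T, A l) :=
    Finset.measurableSet_biInter _ fun l _ => hA l
  have hInd {E : Set Ω} (hE : MeasurableSet E) : Integrable (E.indicator (1 : Ω → ℝ)) P :=
    (integrable_const (1 : ℝ)).indicator hE
  have hP {E : Set Ω} (hE : MeasurableSet E) : (P E).toReal = ∫ ω, E.indicator (1 : Ω → ℝ) ω ∂P :=
    (integral_indicator_one hE).symm
  have hInd₁ (j : ℕ) (c : ℝ) : Integrable (fun ω => c * ∑ T ∈ powersetCard j univ,
      (⋂ l ∈ T, A l).indicator (1 : Ω → ℝ) ω) P :=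
    (integrable_finsetSum _ fun T _ => hInd (hI T)).const_mul c
  have hInd₂ (i j : ℕ) (c : ℝ) : Integrable (fun ω => c * ∑ R ∈ powersetCard j univ,
      (B i R).indicator (1 : Ω → ℝ) ω) P :=
    (integrable_finsetSum _ fun R _ => hInd (hBm i R)).const_mul c
  change (P {ω | r ≤ #(S ω)}).toReal ≤ _
  simp only [hP hX, hP (hI _), hP (hBm _ _)]
  simp only [← integral_finsetSum _ fun T _ => hInd (hI T),
    ← integral_finsetSum _ fun R _ => hInd (hBm _ R), ← integral_const_mul]
  rw [← integral_finsetSum _ fun j _ => hInd₁ j _,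
    ← integral_finsetSum _ fun i _ => hInd₂ i _ _,
    ← integral_sub (integrable_finsetSum _ fun j _ => hInd₁ j _)
      (integrable_finsetSum _ fun i _ => hInd₂ i _ _)]
  refine integral_mono (hInd hX) ((integrable_finsetSum _ fun j _ => hInd₁ j _).sub
      (integrable_finsetSum _ fun i _ => hInd₂ i _ _)) fun ω => ?_
  have hmem (T : Finset (Fin n)) : ω ∈ ⋂ l ∈ T, A l ↔ T ⊆ S ω := by
    simp [S, subset_iff]
  have h₁ (j : ℕ) : ∑ T ∈ powersetCard j univ, (⋂ l ∈ T, A l).indicator (1 : Ω → ℝ) ω =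
      (#(S ω)).choose j := by
    simp only [Set.indicator_apply, hmem, Pi.one_apply, sum_boole]
    rw [← card_powersetCard]
    congr 2
    ext T
    simp [mem_powersetCard, and_comm]
  have h₂ (i j : ℕ) : ∑ R ∈ powersetCard j univ, (B i R).indicator (1 : Ω → ℝ) ω ≤
      ((#(S ω) - i).choose j : ℝ) := by
    simp only [Set.indicator_apply, Pi.one_apply, sum_boole]
    refine Nat.cast_le.mpr (card_le_choose_of_exists_above (S ω) j i _ fun R hR => ?_)
    rw [mem_filter, mem_powersetCard] at hR
    obtain ⟨T, hT, hω⟩ := hBω i R ω hR.2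
    rw [mem_filter, mem_powersetCard] at hT
    exact ⟨hR.1.2, T, hT.1.2, hT.2, by convert (hmem _).mp hω⟩
  simp only [h₁]
  rw [sum_Icc_neg_one_pow_choose r k _ hr1 hrk, heven.neg_one_pow, one_mul, le_sub_iff_add_le]
  simp only [Set.indicator_apply, Set.mem_ofPred_eq, Pi.one_apply]
  gcongr
  exact h₂ _ _
end
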